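/- Let u ∈ C²(closure 𝔻) solve −Δu = 2K e^u in 𝔻 and ∂u/∂ν + 2 = 2h e^{u/2} on ∂𝔻. Then, with F(x,y) := (1 − x² + y², −2xy) (in complex notation F(z) = 1 − z²), the Kazdan–Warner identity ∫_𝔻 e^u (∇K · F) = 4 ∫_{∂𝔻} h_τ e^{u/2} y holds, where h_τ denotes the tangential derivative of h along ∂𝔻 in the direction τ. -/

import Mathlib

open MeasureTheory Filter

noncomputable section

/-- The open unit disk in ℝ² ≅ ℂ. -/
def unitDisk : Set ℂ := Metric.ball 0 1

/-- The closed unit disk. -/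
def unitClosedDisk : Set ℂ := Metric.closedBall 0 1

/-- The unit circle ∂𝔻. -/
def unitCircle : Set ℂ := Metric.sphere 0 1

/-- Arc-length measure: the 1-dimensional Hausdorff measure on ℂ. -/
def arcMeasure : Measure ℂ := μH[1]

/-- Directional derivative of `u` at `z` in direction `v`. -/
def dirDeriv (v : ℂ) (u : ℂ → ℝ) (z : ℂ) : ℝ := fderiv ℝ u z v

/-- Euclidean gradient of `u` at `z`, realized as a complex number. -/
def grad (u : ℂ → ℝ) (z : ℂ) : ℂ := ⟨dirDeriv 1 u z, dirDeriv Complex.I u z⟩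

/-- Euclidean Laplacian. -/
def lap (u : ℂ → ℝ) (z : ℂ) : ℝ :=
  dirDeriv 1 (dirDeriv 1 u) z + dirDeriv Complex.I (dirDeriv Complex.I u) z

/-- Outward normal derivative on the unit circle: ν(z) = z. -/
def normalDeriv (u : ℂ → ℝ) (z : ℂ) : ℝ := fderiv ℝ u z z

/-- Tangential derivative on the unit circle: τ(z) = iz. -/
def tangentialDeriv (u : ℂ → ℝ) (z : ℂ) : ℝ := fderiv ℝ u z (Complex.I * z)

/-- Euclidean dot product on ℂ ≅ ℝ². -/
def dot (z w : ℂ) : ℝ := z.re * w.re + z.im * w.im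

/-- `u` solves `-Δu = 2K e^u` in 𝔻, `∂u/∂ν + 2 = 2h e^{u/2}` on ∂𝔻. -/
def SolvesLiouville (K h u : ℂ → ℝ) : Prop :=
  (∀ z ∈ unitDisk, -lap u z = 2 * K z * Real.exp (u z)) ∧
  (∀ z ∈ unitCircle, normalDeriv u z + 2 = 2 * h z * Real.exp (u z / 2))

/-- Convergence in C² on a set: uniform convergence of the derivatives up to order 2. -/
def TendstoC2On (F : ℕ → ℂ → ℝ) (G : ℂ → ℝ) (s : Set ℂ) : Prop :=
  ∀ i : ℕ, i ≤ 2 →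
    TendstoUniformlyOn (fun n => iteratedFDeriv ℝ i (F n)) (iteratedFDeriv ℝ i G)
      Filter.atTop s

/-- `sup u_n → +∞` on the closed disk. -/
def BlowsUp (u : ℕ → ℂ → ℝ) : Prop :=
  ∀ M : ℝ, ∀ᶠ n in Filter.atTop, ∃ z ∈ unitClosedDisk, M < u n z

/-- `u_n → -∞` locally uniformly on `s`. -/
def TendstoLocallyUniformlyBotOn (u : ℕ → ℂ → ℝ) (s : Set ℂ) : Prop :=
  ∀ (M : ℝ) (S : Set ℂ), IsCompact S → S ⊆ s →
    ∀ᶠ n in Filter.atTop, ∀ z ∈ S, u n z < M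

/-- Bounded total mass: area plus boundary length. -/
def MassBound (u : ℕ → ℂ → ℝ) (C : ℝ) : Prop :=
  ∀ n, (∫ z in unitDisk, Real.exp (u n z)) +
       (∫ z in unitCircle, Real.exp (u n z / 2) ∂arcMeasure) ≤ C

/-- The arc of the unit circle with angles within `δ` of `c` has length at least `2 sin δ`. -/
lemma ofReal_two_mul_sin_le_hausdorffMeasure_arc (c : ℝ) {δ : ℝ} (h0 : 0 ≤ δ)
    (hδ : δ ≤ Real.pi / 2) :
    ENNReal.ofReal (2 * Real.sin δ) ≤ μH[1] (circleMap 0 1 '' Set.Ioo (c - δ) (c + δ)) := by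
  set f : ℂ → ℝ := fun z => (z * Complex.exp (-c * Complex.I)).im
  have hf : LipschitzWith 1 f := by
    refine LipschitzWith.of_dist_le_mul fun z w => ?_
    have h1 : ‖Complex.exp (-c * Complex.I)‖ = 1 := by
      simpa using Complex.norm_exp_ofReal_mul_I (-c)
    calc dist (f z) (f w) = |((z - w) * Complex.exp (-c * Complex.I)).im| := by
          rw [Real.dist_eq, sub_mul, Complex.sub_im]
      _ ≤ ‖(z - w) * Complex.exp (-c * Complex.I)‖ := Complex.abs_im_le_norm _
      _ = (1 : NNReal) * dist z w := by rw [norm_mul, h1, mul_one, dist_eq_norm]; simp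
  have hfc (θ : ℝ) : f (circleMap 0 1 θ) = Real.sin (θ - c) := by
    have : circleMap 0 1 θ * Complex.exp (-c * Complex.I)
        = Complex.exp ((θ - c : ℝ) * Complex.I) := by
      rw [circleMap_zero, Complex.ofReal_one, one_mul, ← Complex.exp_add]
      congr 1; push_cast; ring
    simp only [f, this, Complex.exp_ofReal_mul_I_im]
  have hsub : Set.Ioo (-Real.sin δ) (Real.sin δ) ⊆
      f '' (circleMap 0 1 '' Set.Ioo (c - δ) (c + δ)) := by
    intro s hs
    have hlow : -1 ≤ s := by linarith [hs.1, Real.sin_le_one δ]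
    have hhigh : s ≤ 1 := by linarith [hs.2, Real.sin_le_one δ]
    refine ⟨_, ⟨c + Real.arcsin s, ⟨?_, ?_⟩, rfl⟩, ?_⟩
    · have : -δ < Real.arcsin s :=
        (Real.lt_arcsin_iff_sin_lt' ⟨by linarith, by linarith [Real.pi_pos]⟩).2
          (by rw [Real.sin_neg]; exact hs.1)
      linarith
    · have : Real.arcsin s < δ :=
        (Real.arcsin_lt_iff_lt_sin' ⟨by linarith [Real.pi_pos], hδ⟩).2 hs.2
      linarith
    · rw [hfc, add_sub_cancel_left, Real.sin_arcsin hlow hhigh]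
  calc ENNReal.ofReal (2 * Real.sin δ) = volume (Set.Ioo (-Real.sin δ) (Real.sin δ)) := by
        rw [Real.volume_Ioo]; congr 1; ring
    _ ≤ volume (f '' (circleMap 0 1 '' Set.Ioo (c - δ) (c + δ))) := measure_mono hsub
    _ ≤ μH[1] (circleMap 0 1 '' Set.Ioo (c - δ) (c + δ)) := by
        simpa [← hausdorffMeasure_real] using
          hf.hausdorffMeasure_image_le zero_le_one (circleMap 0 1 '' Set.Ioo (c - δ) (c + δ))

lemma injOn_circleMap_Ioc : Set.InjOn (circleMap 0 1) (Set.Ioc (-Real.pi) Real.pi) := by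
  rw [← Set.uIoc_of_le (by linarith [Real.pi_pos])]
  refine injOn_circleMap_of_abs_sub_le one_ne_zero (le_of_eq ?_)
  rw [abs_of_neg] <;> linarith [Real.pi_pos]

lemma image_circleMap_Ioc_neg_pi_pi :
    circleMap 0 1 '' Set.Ioc (-Real.pi) Real.pi = unitCircle := by
  have h := (periodic_circleMap 0 1).image_Ioc Real.two_pi_pos (-Real.pi)
  rw [show -Real.pi + 2 * Real.pi = Real.pi by ring] at h
  rw [h, range_circleMap, abs_one, unitCircle]

lemma ofReal_mul_sin_le_hausdorffMeasure_unitCircle {n : ℕ} (hn : 2 ≤ n) :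
    ENNReal.ofReal (n * (2 * Real.sin (Real.pi / n))) ≤ μH[1] unitCircle := by
  have hn0 : (0 : ℝ) < n := by positivity
  have hn2 : (2 : ℝ) ≤ n := by exact_mod_cast hn
  have hpi := Real.pi_pos
  set δ := Real.pi / n with hδ
  have hδ0 : 0 < δ := by positivity
  have hδn : n * δ = Real.pi := by rw [hδ]; field_simp
  have hδ2 : δ ≤ Real.pi / 2 := by rw [hδ]; gcongr
  set c : ℕ → ℝ := fun k => -Real.pi + (2 * k + 1) * δ with hc
  have hIoc : ∀ k < n, Set.Ioo (c k - δ) (c k + δ) ⊆ Set.Ioc (-Real.pi) Real.pi := by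
    intro k hk x hx
    have hk' : (k : ℝ) + 1 ≤ n := by exact_mod_cast hk
    have h1 : ((k : ℝ) + 1) * δ ≤ n * δ := by gcongr
    have h2 : 0 ≤ (k : ℝ) * δ := by positivity
    simp only [hc, Set.mem_Ioo] at hx
    constructor <;> nlinarith [hx.1, hx.2]
  have hdisj : Set.PairwiseDisjoint (↑(Finset.range n))
      (fun k => circleMap 0 1 '' Set.Ioo (c k - δ) (c k + δ)) := by
    intro j hj k hk hjk
    have hj' : j < n := by simpa using hj
    have hk' : k < n := by simpa using hk
    have hij : Disjoint (Set.Ioo (c j - δ) (c j + δ)) (Set.Ioo (c k - δ) (c k + δ)) := by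
      rw [Set.disjoint_left]
      intro x hx hy
      simp only [hc, Set.mem_Ioo] at hx hy
      rcases lt_or_gt_of_ne hjk with h | h
      · have h' : (j : ℝ) + 1 ≤ k := by exact_mod_cast h
        nlinarith [mul_le_mul_of_nonneg_right h' hδ0.le]
      · have h' : (k : ℝ) + 1 ≤ j := by exact_mod_cast h
        nlinarith [mul_le_mul_of_nonneg_right h' hδ0.le]
    refine Set.disjoint_left.2 ?_
    rintro _ ⟨x, hx, rfl⟩ ⟨y, hy, hxy⟩
    have hyx : y = x := injOn_circleMap_Ioc (hIoc k hk' hy) (hIoc j hj' hx) hxy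
    exact Set.disjoint_left.1 hij hx (hyx ▸ hy)
  have hmeas : ∀ k ∈ Finset.range n,
      MeasurableSet (circleMap 0 1 '' Set.Ioo (c k - δ) (c k + δ)) := fun k hk =>
    measurableSet_Ioo.image_of_continuousOn_injOn (continuous_circleMap 0 1).continuousOn
      (injOn_circleMap_Ioc.mono (hIoc k (by simpa using hk)))
  calc ENNReal.ofReal (n * (2 * Real.sin δ))
      = ∑ _k ∈ Finset.range n, ENNReal.ofReal (2 * Real.sin δ) := by
        rw [Finset.sum_const, Finset.card_range, nsmul_eq_mul,
          ENNReal.ofReal_mul hn0.le, ENNReal.ofReal_natCast]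
    _ ≤ ∑ k ∈ Finset.range n, μH[1] (circleMap 0 1 '' Set.Ioo (c k - δ) (c k + δ)) :=
        Finset.sum_le_sum fun k _ =>
          ofReal_two_mul_sin_le_hausdorffMeasure_arc (c k) hδ0.le hδ2
    _ = μH[1] (⋃ k ∈ Finset.range n, circleMap 0 1 '' Set.Ioo (c k - δ) (c k + δ)) :=
        (measure_biUnion_finset hdisj hmeas).symm
    _ ≤ μH[1] unitCircle := by
        refine measure_mono (Set.iUnion₂_subset fun k hk => ?_)
        rw [← image_circleMap_Ioc_neg_pi_pi]
        exact Set.image_mono (hIoc k (by simpa using hk))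

lemma ofReal_two_mul_pi_le_hausdorffMeasure_unitCircle :
    ENNReal.ofReal (2 * Real.pi) ≤ μH[1] unitCircle := by
  have hlim : Tendsto (fun n : ℕ => ENNReal.ofReal (2 * Real.pi - Real.pi ^ 3 / 3 * (1 / (n : ℝ))))
      atTop (nhds (ENNReal.ofReal (2 * Real.pi))) := by
    refine (ENNReal.continuous_ofReal.tendsto _).comp ?_
    simpa using (tendsto_one_div_atTop_nhds_zero_nat.const_mul (Real.pi ^ 3 / 3)).const_sub
      (2 * Real.pi)
  refine le_of_tendsto hlim (eventually_atTop.2 ⟨2, fun n hn => ?_⟩)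
  refine le_trans (ENNReal.ofReal_le_ofReal ?_)
    (ofReal_mul_sin_le_hausdorffMeasure_unitCircle hn)
  have hn1 : (1 : ℝ) ≤ n := by exact_mod_cast (by omega : 1 ≤ n)
  have hpi := Real.pi_pos
  have h := Real.sin_ge_sub_cube (x := Real.pi / n) (by positivity)
  calc 2 * Real.pi - Real.pi ^ 3 / 3 * (1 / (n : ℝ))
      ≤ 2 * Real.pi - Real.pi ^ 3 / 3 * (1 / (n : ℝ) ^ 2) := by
        gcongr
        nlinarith
    _ = n * (2 * (Real.pi / n - (Real.pi / n) ^ 3 / 6)) := by field_simp; ring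
    _ ≤ n * (2 * Real.sin (Real.pi / n)) := by gcongr

/-- The one-dimensional Hausdorff measure on the unit circle is the image of Lebesgue measure
under the angular parametrization. -/
lemma arcMeasure_restrict_unitCircle :
    arcMeasure.restrict unitCircle =
      (volume.restrict (Set.Ioc (-Real.pi) Real.pi)).map (circleMap 0 1) := by
  have hm : Measurable (circleMap 0 1) := (continuous_circleMap 0 1).measurable
  have hlip : LipschitzWith 1 (circleMap 0 1) := by
    simpa using lipschitzWith_circleMap 0 1
  have hle : arcMeasure.restrict unitCircle ≤
      (volume.restrict (Set.Ioc (-Real.pi) Real.pi)).map (circleMap 0 1) := by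
    refine Measure.le_iff.2 fun s hs => ?_
    rw [Measure.map_apply hm hs, Measure.restrict_apply hs, Measure.restrict_apply (hm hs),
      ← image_circleMap_Ioc_neg_pi_pi, Set.inter_comm, Set.inter_comm _ (Set.Ioc _ _),
      ← Set.image_inter_preimage, ← hausdorffMeasure_real]
    simpa [arcMeasure] using hlip.hausdorffMeasure_image_le zero_le_one _
  have huniv : ((volume.restrict (Set.Ioc (-Real.pi) Real.pi)).map (circleMap 0 1)) Set.univ
      = ENNReal.ofReal (2 * Real.pi) := by
    rw [Measure.map_apply hm .univ, Set.preimage_univ, Measure.restrict_apply_univ,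
      Real.volume_Ioc]
    congr 1; ring
  have : IsFiniteMeasure (arcMeasure.restrict unitCircle) :=
    ⟨(hle Set.univ).trans_lt (by rw [huniv]; exact ENNReal.ofReal_lt_top)⟩
  refine Measure.eq_of_le_of_measure_univ_eq hle (le_antisymm (hle _) ?_)
  rw [huniv, Measure.restrict_apply_univ]
  exact ofReal_two_mul_pi_le_hausdorffMeasure_unitCircle

lemma setIntegral_unitCircle_arcMeasure {f : ℂ → ℝ} (hf : Continuous f) :
    ∫ z in unitCircle, f z ∂arcMeasure = ∫ θ in (-Real.pi)..Real.pi, f (circleMap 0 1 θ) := by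
  rw [arcMeasure_restrict_unitCircle,
    integral_map (continuous_circleMap 0 1).aemeasurable hf.aestronglyMeasurable,
    intervalIntegral.integral_of_le (by linarith [Real.pi_pos])]

lemma fderiv_apply_eq_dirDeriv (f : ℂ → ℝ) (z w : ℂ) :
    fderiv ℝ f z w = w.re * dirDeriv 1 f z + w.im * dirDeriv Complex.I f z := by
  have hw : w = w.re • (1 : ℂ) + w.im • Complex.I := by
    apply Complex.ext <;> simp
  conv_lhs => rw [hw, map_add, map_smul, map_smul]
  rfl

lemma continuous_dirDeriv {f : ℂ → ℝ} (hf : ContDiff ℝ 1 f) (v : ℂ) :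
    Continuous (dirDeriv v f) :=
  (hf.continuous_fderiv one_ne_zero).clm_apply continuous_const

lemma hasDerivAt_comp_path {f : ℂ → ℝ} (hf : ContDiff ℝ 1 f) {γ : ℝ → ℂ} {γ' : ℂ} {t : ℝ}
    (hγ : HasDerivAt γ γ' t) :
    HasDerivAt (fun s => f (γ s)) (fderiv ℝ f (γ t) γ') t :=
  ((hf.differentiable one_ne_zero (γ t)).hasFDerivAt).comp_hasDerivAt t hγ

lemma hasDerivAt_circleMap_radius (r θ : ℝ) :
    HasDerivAt (fun s : ℝ => circleMap 0 s θ) (circleMap 0 1 θ) r := by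
  simp only [circleMap_zero]
  simpa using (Complex.ofRealCLM.hasDerivAt (x := r)).mul_const (Complex.exp (θ * Complex.I))

lemma continuous_circleMap_uncurry : Continuous fun p : ℝ × ℝ => circleMap 0 p.1 p.2 := by
  simp only [circleMap_zero]
  fun_prop

/-- Integration over the unit disk in polar coordinates. -/
lemma setIntegral_unitDisk (f : ℂ → ℝ) :
    ∫ z in unitDisk, f z =
      ∫ p in Set.Ioc (0 : ℝ) 1 ×ˢ Set.Ioc (-Real.pi) Real.pi, p.1 * f (circleMap 0 p.1 p.2) := by
  have hpol (p : ℝ × ℝ) : Complex.polarCoord.symm p = circleMap 0 p.1 p.2 := by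
    rw [Complex.polarCoord_symm_apply, circleMap_zero, Complex.exp_mul_I]
    push_cast; rfl
  have hae : (Set.Ioo (0 : ℝ) 1 ×ˢ Set.Ioo (-Real.pi) Real.pi : Set (ℝ × ℝ)) =ᵐ[volume]
      (Set.Ioc (0 : ℝ) 1 ×ˢ Set.Ioc (-Real.pi) Real.pi : Set (ℝ × ℝ)) :=
    Measure.set_prod_ae_eq Ioo_ae_eq_Ioc Ioo_ae_eq_Ioc
  rw [unitDisk, ← integral_indicator measurableSet_ball, ← Complex.integral_comp_polarCoord_symm,
    ← setIntegral_congr_set hae, ← integral_indicator (measurableSet_Ioo.prod measurableSet_Ioo),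
    ← integral_indicator (polarCoord.open_target.measurableSet)]
  congr 1
  ext ⟨r, θ⟩
  simp only [Set.indicator, polarCoord_target, Set.mem_prod, Set.mem_Ioi, Set.mem_Ioo, hpol,
    Metric.mem_ball, dist_zero_right, norm_circleMap_zero, smul_eq_mul, mul_ite, mul_zero]
  by_cases h0 : 0 < r
  · simp only [abs_of_pos h0, h0, true_and]
    split_ifs <;> tauto
  · simp [h0]

/-- The divergence theorem on the unit disk, for the vector field `(P, Q)`. -/
lemma integral_divergence_unitDisk {P Q : ℂ → ℝ} (hP : ContDiff ℝ 1 P) (hQ : ContDiff ℝ 1 Q) :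
    ∫ z in unitDisk, (dirDeriv 1 P z + dirDeriv Complex.I Q z) =
      ∫ θ in (-Real.pi)..Real.pi,
        (P (circleMap 0 1 θ) * Real.cos θ + Q (circleMap 0 1 θ) * Real.sin θ) := by
  have hpi : -Real.pi ≤ Real.pi := by linarith [Real.pi_pos]
  set E : ℝ → ℝ → ℂ := circleMap 0 with hE
  have hEc : Continuous fun p : ℝ × ℝ => E p.1 p.2 := continuous_circleMap_uncurry
  have hPc := hP.continuous.comp hEc
  have hQc := hQ.continuous.comp hEc
  have hPx := (continuous_dirDeriv hP 1).comp hEc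
  have hPy := (continuous_dirDeriv hP Complex.I).comp hEc
  have hQx := (continuous_dirDeriv hQ 1).comp hEc
  have hQy := (continuous_dirDeriv hQ Complex.I).comp hEc
  simp only [Function.comp_def] at hPc hQc hPx hPy hQx hQy
  set A : ℝ × ℝ → ℝ := fun p =>
    (P (E p.1 p.2) * Real.cos p.2 + Q (E p.1 p.2) * Real.sin p.2) +
    p.1 * ((Real.cos p.2 * dirDeriv 1 P (E p.1 p.2)
        + Real.sin p.2 * dirDeriv Complex.I P (E p.1 p.2)) * Real.cos p.2 +
      (Real.cos p.2 * dirDeriv 1 Q (E p.1 p.2)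
        + Real.sin p.2 * dirDeriv Complex.I Q (E p.1 p.2)) * Real.sin p.2) with hA
  set B : ℝ × ℝ → ℝ := fun p =>
    -((-(p.1 * Real.sin p.2) * dirDeriv 1 P (E p.1 p.2)
        + p.1 * Real.cos p.2 * dirDeriv Complex.I P (E p.1 p.2)) * Real.sin p.2
      + P (E p.1 p.2) * Real.cos p.2) +
    ((-(p.1 * Real.sin p.2) * dirDeriv 1 Q (E p.1 p.2)
        + p.1 * Real.cos p.2 * dirDeriv Complex.I Q (E p.1 p.2)) * Real.cos p.2
      + Q (E p.1 p.2) * -Real.sin p.2) with hB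
  have hAc : Continuous A := by fun_prop
  have hBc : Continuous B := by fun_prop
  have hAB (p : ℝ × ℝ) :
      p.1 * (dirDeriv 1 P (E p.1 p.2) + dirDeriv Complex.I Q (E p.1 p.2)) = A p + B p := by
    simp only [hA, hB]
    linear_combination (-p.1 * (dirDeriv 1 P (E p.1 p.2) + dirDeriv Complex.I Q (E p.1 p.2))) *
      Real.sin_sq_add_cos_sq p.2
  have hint {g : ℝ × ℝ → ℝ} (hg : Continuous g) :
      IntegrableOn g (Set.Ioc (0 : ℝ) 1 ×ˢ Set.Ioc (-Real.pi) Real.pi) (volume.prod volume) :=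
    (hg.continuousOn.integrableOn_compact (isCompact_Icc.prod isCompact_Icc)).mono_set
      (Set.prod_mono Set.Ioc_subset_Icc_self Set.Ioc_subset_Icc_self)
  have hAr (θ : ℝ) : ∫ r in Set.Ioc (0 : ℝ) 1, A (r, θ) =
      P (E 1 θ) * Real.cos θ + Q (E 1 θ) * Real.sin θ := by
    have hd (r : ℝ) : HasDerivAt
        (fun s => s * (P (E s θ) * Real.cos θ + Q (E s θ) * Real.sin θ)) (A (r, θ)) r := by
      have hγ := hasDerivAt_circleMap_radius r θ
      refine ((hasDerivAt_id' r).fun_mul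
        (((hasDerivAt_comp_path hP hγ).mul_const (Real.cos θ)).fun_add
          ((hasDerivAt_comp_path hQ hγ).mul_const (Real.sin θ)))).congr_deriv ?_
      simp only [hA, hE, fderiv_apply_eq_dirDeriv, circleMap_zero_re, circleMap_zero_im, one_mul]
    rw [← intervalIntegral.integral_of_le zero_le_one,
      intervalIntegral.integral_eq_sub_of_hasDerivAt (fun r _ => hd r)
        ((by fun_prop : Continuous fun r => A (r, θ)).intervalIntegrable _ _)]
    ring
  have hBθ (r : ℝ) : ∫ θ in Set.Ioc (-Real.pi) Real.pi, B (r, θ) = 0 := by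
    have hd (θ : ℝ) : HasDerivAt
        (fun s => -(P (E r s) * Real.sin s) + Q (E r s) * Real.cos s) (B (r, θ)) θ := by
      have hγ := hasDerivAt_circleMap 0 r θ
      refine (((hasDerivAt_comp_path hP hγ).fun_mul (Real.hasDerivAt_sin θ)).fun_neg.fun_add
        ((hasDerivAt_comp_path hQ hγ).fun_mul (Real.hasDerivAt_cos θ))).congr_deriv ?_
      simp only [hB, hE, fderiv_apply_eq_dirDeriv, Complex.mul_I_re, Complex.mul_I_im,
        circleMap_zero_re, circleMap_zero_im]
    rw [← intervalIntegral.integral_of_le hpi,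
      intervalIntegral.integral_eq_sub_of_hasDerivAt (fun θ _ => hd θ)
        ((by fun_prop : Continuous fun θ => B (r, θ)).intervalIntegrable _ _)]
    have hper : E r (-Real.pi) = E r Real.pi := by
      have := periodic_circleMap 0 r (-Real.pi)
      rw [show -Real.pi + 2 * Real.pi = Real.pi by ring] at this
      exact this.symm
    simp [hper]
  rw [setIntegral_unitDisk]
  simp only [← hE, hAB]
  rw [Measure.volume_eq_prod, integral_add (hint hAc) (hint hBc), setIntegral_prod _ (hint hBc)]
  simp only [hBθ, integral_zero, add_zero]
  rw [setIntegral_prod _ (hint hAc), integral_integral_swap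
    (by rw [Measure.prod_restrict]; exact hint hAc)]
  simp only [hAr]
  rw [intervalIntegral.integral_of_le hpi]

lemma dirDeriv_comm {u : ℂ → ℝ} (hu : ContDiff ℝ 2 u) (v w z : ℂ) :
    dirDeriv v (dirDeriv w u) z = dirDeriv w (dirDeriv v u) z := by
  have hd : DifferentiableAt ℝ (fderiv ℝ u) z :=
    (hu.fderiv_right (m := 1) (by norm_num)).differentiable one_ne_zero z
  have key (v w : ℂ) : dirDeriv v (dirDeriv w u) z = fderiv ℝ (fderiv ℝ u) z v w := by
    have h : HasFDerivAt (dirDeriv w u) _ z := hd.hasFDerivAt.clm_apply (hasFDerivAt_const w z)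
    rw [dirDeriv, h.fderiv]
    simp
  rw [key, key]
  exact (hu.contDiffAt.isSymmSndFDerivAt (by simp)) v w

/-- First component of the Kazdan-Warner field, whose divergence on the disk is `e^u (∇K · F)`
for `F z = 1 - z ^ 2` when `-Δu = 2 K e^u`. -/
def kazdanWarnerFieldRe (K u : ℂ → ℝ) (z : ℂ) : ℝ :=
  K z * Real.exp (u z) * (1 - z.re * z.re + z.im * z.im) +
    ((dirDeriv 1 u z * (1 - z.re * z.re + z.im * z.im)
        - dirDeriv Complex.I u z * (2 * (z.re * z.im))) * dirDeriv 1 u z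
      - (dirDeriv 1 u z * dirDeriv 1 u z + dirDeriv Complex.I u z * dirDeriv Complex.I u z)
        * (1 - z.re * z.re + z.im * z.im) * (1 / 2)
      - z.re * dirDeriv 1 u z * 4 + u z * 4) * (1 / 2)

/-- Second component of the Kazdan-Warner field. -/
def kazdanWarnerFieldIm (K u : ℂ → ℝ) (z : ℂ) : ℝ :=
  -(K z * Real.exp (u z) * (2 * (z.re * z.im))) +
    ((dirDeriv 1 u z * (1 - z.re * z.re + z.im * z.im)
        - dirDeriv Complex.I u z * (2 * (z.re * z.im))) * dirDeriv Complex.I u z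
      + (dirDeriv 1 u z * dirDeriv 1 u z + dirDeriv Complex.I u z * dirDeriv Complex.I u z)
        * (2 * (z.re * z.im)) * (1 / 2)
      - z.re * dirDeriv Complex.I u z * 4) * (1 / 2)

section KazdanWarnerField

variable {K u : ℂ → ℝ}

lemma contDiff_dirDeriv (hu : ContDiff ℝ 2 u) (v : ℂ) : ContDiff ℝ 1 (dirDeriv v u) :=
  (hu.fderiv_right (m := 1) (by norm_num)).clm_apply contDiff_const

lemma contDiff_kazdanWarnerFieldRe (hu : ContDiff ℝ 2 u) (hK : ContDiff ℝ 1 K) :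
    ContDiff ℝ 1 (kazdanWarnerFieldRe K u) := by
  have hu1 : ContDiff ℝ 1 u := hu.of_le (by norm_num)
  have ha := contDiff_dirDeriv hu 1
  have hb := contDiff_dirDeriv hu Complex.I
  have hre : ContDiff ℝ 1 Complex.re := Complex.reCLM.contDiff
  have him : ContDiff ℝ 1 Complex.im := Complex.imCLM.contDiff
  unfold kazdanWarnerFieldRe
  fun_prop

lemma contDiff_kazdanWarnerFieldIm (hu : ContDiff ℝ 2 u) (hK : ContDiff ℝ 1 K) :
    ContDiff ℝ 1 (kazdanWarnerFieldIm K u) := by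
  have hu1 : ContDiff ℝ 1 u := hu.of_le (by norm_num)
  have ha := contDiff_dirDeriv hu 1
  have hb := contDiff_dirDeriv hu Complex.I
  have hre : ContDiff ℝ 1 Complex.re := Complex.reCLM.contDiff
  have him : ContDiff ℝ 1 Complex.im := Complex.imCLM.contDiff
  unfold kazdanWarnerFieldIm
  fun_prop

lemma divergence_kazdanWarnerField (hu : ContDiff ℝ 2 u) (hK : ContDiff ℝ 1 K) {z : ℂ}
    (hz : -lap u z = 2 * K z * Real.exp (u z)) :
    dirDeriv 1 (kazdanWarnerFieldRe K u) z + dirDeriv Complex.I (kazdanWarnerFieldIm K u) z =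
      Real.exp (u z) * dot (grad K z) (1 - z ^ 2) := by
  have hK' := (hK.differentiable one_ne_zero z).hasFDerivAt
  have hu' := (hu.differentiable two_ne_zero z).hasFDerivAt
  have ha := ((contDiff_dirDeriv hu 1).differentiable one_ne_zero z).hasFDerivAt
  have hb := ((contDiff_dirDeriv hu Complex.I).differentiable one_ne_zero z).hasFDerivAt
  have hre : HasFDerivAt Complex.re Complex.reCLM z := Complex.reCLM.hasFDerivAt
  have him : HasFDerivAt Complex.im Complex.imCLM z := Complex.imCLM.hasFDerivAt
  have hF₁ := ((hre.fun_mul hre).const_sub 1).fun_add (him.fun_mul him)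
  have hF₂ := (hre.fun_mul him).const_mul 2
  have hdot := (ha.fun_mul hF₁).fun_sub (hb.fun_mul hF₂)
  have hsq := (ha.fun_mul ha).fun_add (hb.fun_mul hb)
  have hP : HasFDerivAt (kazdanWarnerFieldRe K u) _ z :=
    ((hK'.fun_mul hu'.exp).fun_mul hF₁).fun_add
      (((((hdot.fun_mul ha).fun_sub ((hsq.fun_mul hF₁).mul_const (1 / 2))).fun_sub
        ((hre.fun_mul ha).mul_const 4)).fun_add (hu'.mul_const 4)).mul_const (1 / 2))
  have hQ : HasFDerivAt (kazdanWarnerFieldIm K u) _ z :=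
    ((hK'.fun_mul hu'.exp).fun_mul hF₂).fun_neg.fun_add
      ((((hdot.fun_mul hb).fun_add ((hsq.fun_mul hF₂).mul_const (1 / 2))).fun_sub
        ((hre.fun_mul hb).mul_const 4)).mul_const (1 / 2))
  have hfd (v : ℂ) (f : ℂ → ℝ) : fderiv ℝ f z v = dirDeriv v f z := rfl
  rw [dirDeriv, dirDeriv, hP.fderiv, hQ.fderiv]
  simp only [_root_.add_apply, _root_.sub_apply,
    _root_.neg_apply, _root_.smul_apply, smul_eq_mul, hfd,
    Complex.reCLM_apply, Complex.imCLM_apply, Complex.one_re, Complex.one_im, Complex.I_re,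
    Complex.I_im, dot, grad, Complex.sub_re, Complex.sub_im, pow_two, Complex.mul_re,
    Complex.mul_im]
  rw [lap] at hz
  linear_combination
    (-(1 / 2) * (dirDeriv 1 u z * (1 - z.re * z.re + z.im * z.im)
      - dirDeriv Complex.I u z * (2 * (z.re * z.im)) - 4 * z.re)) * hz
    + (1 / 2) * (dirDeriv Complex.I u z * (1 - z.re * z.re + z.im * z.im)
      + dirDeriv 1 u z * (2 * (z.re * z.im))) * dirDeriv_comm hu Complex.I 1 z

end KazdanWarnerField

/-- the Kazdan–Warner identity
`∫_𝔻 e^u ∇K·F = 4 ∫_{∂𝔻} h_τ e^{u/2} y` with `F(z) = 1 - z²`. -/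
theorem kazdan_warner_identity
    (K h u : ℂ → ℝ)
    (hureg : ContDiff ℝ 2 u) (hKreg : ContDiff ℝ 1 K) (hhreg : ContDiff ℝ 1 h)
    (hsol : SolvesLiouville K h u) :
    (∫ z in unitDisk, Real.exp (u z) * dot (grad K z) (1 - z ^ 2))
    = 4 * ∫ z in unitCircle,
        tangentialDeriv h z * Real.exp (u z / 2) * z.im ∂arcMeasure := by
  have hu1 : ContDiff ℝ 1 u := hureg.of_le (by norm_num)
  have huc := hu1.continuous
  have hhc := hhreg.continuous
  have htang {f : ℂ → ℝ} (hf : ContDiff ℝ 1 f) : Continuous (tangentialDeriv f) :=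
    (hf.continuous_fderiv one_ne_zero).clm_apply (by fun_prop)
  have hut := htang hu1
  have hht := htang hhreg
  have hP := contDiff_kazdanWarnerFieldRe hureg hKreg
  have hQ := contDiff_kazdanWarnerFieldIm hureg hKreg
  have hPc := hP.continuous
  have hQc := hQ.continuous
  set E : ℝ → ℂ := circleMap 0 1 with hE
  have hEc : Continuous E := continuous_circleMap 0 1
  have hdisk : MeasurableSet unitDisk := measurableSet_ball
  rw [← setIntegral_congr_fun hdisk
      (fun z hz => divergence_kazdanWarnerField hureg hKreg (hsol.1 z hz)),
    integral_divergence_unitDisk hP hQ,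
    setIntegral_unitCircle_arcMeasure (by fun_prop), ← intervalIntegral.integral_const_mul,
    ← sub_eq_zero, ← intervalIntegral.integral_sub
      (by apply Continuous.intervalIntegrable; fun_prop)
      (by apply Continuous.intervalIntegrable; fun_prop)]
  set Φ' : ℝ → ℝ := fun θ => 2 * (Real.cos θ * u (E θ) + Real.sin θ * tangentialDeriv u (E θ))
    + 4 * Real.cos θ
    - 4 * ((tangentialDeriv h (E θ) * Real.exp (u (E θ) / 2)
      + h (E θ) * (Real.exp (u (E θ) / 2) * (tangentialDeriv u (E θ) / 2))) * Real.sin θ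
      + h (E θ) * Real.exp (u (E θ) / 2) * Real.cos θ) with hΦ'
  have hΦ (θ : ℝ) : HasDerivAt (fun t => 2 * (Real.sin t * u (E t)) + 4 * Real.sin t
      - 4 * (h (E t) * Real.exp (u (E t) / 2) * Real.sin t)) (Φ' θ) θ := by
    have hγ : HasDerivAt E (Complex.I * E θ) θ := by
      rw [mul_comm]; exact hasDerivAt_circleMap 0 1 θ
    have hu' := hasDerivAt_comp_path hu1 hγ
    have hh' := hasDerivAt_comp_path hhreg hγ
    have hs := Real.hasDerivAt_sin θ
    exact (((hs.fun_mul hu').const_mul 2).fun_add (hs.const_mul 4)).fun_sub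
      (((hh'.fun_mul (hu'.div_const 2).exp).fun_mul hs).const_mul 4)
  rw [intervalIntegral.integral_congr (g := Φ'),
    intervalIntegral.integral_eq_sub_of_hasDerivAt (fun θ _ => hΦ θ)
      (by apply Continuous.intervalIntegrable; fun_prop)]
  · simp
  intro θ _
  have hbd := hsol.2 (E θ) (by simp [unitCircle, hE])
  have hre : (E θ).re = Real.cos θ := by rw [hE, circleMap_zero_re, one_mul]
  have him : (E θ).im = Real.sin θ := by rw [hE, circleMap_zero_im, one_mul]
  have ht : tangentialDeriv u (E θ) = -Real.sin θ * dirDeriv 1 u (E θ)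
      + Real.cos θ * dirDeriv Complex.I u (E θ) := by
    rw [tangentialDeriv, fderiv_apply_eq_dirDeriv, Complex.I_mul_re, Complex.I_mul_im, hre, him]
  rw [normalDeriv, fderiv_apply_eq_dirDeriv, hre, him] at hbd
  simp only [hΦ', kazdanWarnerFieldRe, kazdanWarnerFieldIm, ← hE, hre, him, ht]
  have hcs := Real.sin_sq_add_cos_sq θ
  set a := dirDeriv 1 u (E θ)
  set b := dirDeriv Complex.I u (E θ)
  set c := Real.cos θ
  set s := Real.sin θ
  have hF : 1 - c * c + s * s = 2 * s ^ 2 := by linear_combination -hcs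
  rw [hF]
  linear_combination (-s * (-s * a + c * b) - 2 * c) * hbd
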